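/- Let P = [[Q, S],[Sᵀ, R]] be a symmetric (p+q)×(p+q) real matrix with Q ⪯ 0, and let D̄₁, …, D̄_c ∈ ℝ^{q×p} satisfy [D̄ᵢᵀ; I]ᵀ P [D̄ᵢᵀ; I] ⪰ 0 for each i. Then every convex combination D = Σᵢ λᵢ D̄ᵢ (λᵢ ≥ 0, Σλᵢ = 1) satisfies [Dᵀ; I]ᵀ P [Dᵀ; I] ⪰ 0. -/

import Mathlib

open Matrix

/-- The defect in the convexity inequality for `D ↦ D Q Dᵀ + D S + Sᵀ Dᵀ + R` is the weighted
variance of the points with respect to `-Q`. -/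
theorem quadratic_sum_smul_eq {ι m n : Type*} [Fintype ι] [Fintype m]
    (Q : Matrix m m ℝ) (S : Matrix m n ℝ) (R : Matrix n n ℝ) (A : ι → Matrix n m ℝ)
    (l : ι → ℝ) (hsum : ∑ i, l i = 1) (D : Matrix n m ℝ) (hD : ∑ i, l i • A i = D) :
    D * Q * Dᵀ + D * S + Sᵀ * Dᵀ + R =
      ∑ i, l i • ((A i * Q * (A i)ᵀ + A i * S + Sᵀ * (A i)ᵀ + R)
        + (A i - D) * (-Q) * (A i - D)ᵀ) := by
  have hterm : ∀ i, l i • ((A i * Q * (A i)ᵀ + A i * S + Sᵀ * (A i)ᵀ + R)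
        + (A i - D) * (-Q) * (A i - D)ᵀ) =
      (l i • A i) * (Q * Dᵀ + S) + (D * Q + Sᵀ) * (l i • A i)ᵀ
        + l i • (R - D * Q * Dᵀ) := by
    intro i
    simp only [Matrix.transpose_smul, Matrix.smul_mul, Matrix.mul_smul, ← smul_add]
    congr 1
    simp only [Matrix.transpose_sub, Matrix.sub_mul, Matrix.mul_sub, Matrix.add_mul,
      Matrix.mul_add, Matrix.mul_neg, Matrix.neg_mul, Matrix.mul_assoc]
    abel
  simp only [hterm, Finset.sum_add_distrib, ← Matrix.sum_mul, ← Matrix.mul_sum,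
    ← Matrix.transpose_sum, ← Finset.sum_smul, hsum, hD, one_smul]
  simp only [Matrix.add_mul, Matrix.mul_add, Matrix.mul_assoc]
  abel

/-- Convex-hull multipliers: if each vertex `D̄ᵢ` satisfies the quadratic
constraint `D̄ᵢQD̄ᵢᵀ + D̄ᵢS + SᵀD̄ᵢᵀ + R ⪰ 0` with `Q ⪯ 0`, then so does
every convex combination. -/
theorem stmt_6 (p q c : ℕ)
    (Q : Matrix (Fin p) (Fin p) ℝ) (S : Matrix (Fin p) (Fin q) ℝ)
    (R : Matrix (Fin q) (Fin q) ℝ)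
    (hQ : (-Q).PosSemidef)
    (Dbar : Fin c → Matrix (Fin q) (Fin p) ℝ)
    (hvert : ∀ i, ((Dbar i) * Q * (Dbar i)ᵀ + (Dbar i) * S + Sᵀ * (Dbar i)ᵀ + R).PosSemidef)
    (l : Fin c → ℝ) (hl : ∀ i, 0 ≤ l i) (hsum : ∑ i, l i = 1) :
    (((∑ i, l i • Dbar i) * Q * (∑ i, l i • Dbar i)ᵀ
      + (∑ i, l i • Dbar i) * S + Sᵀ * (∑ i, l i • Dbar i)ᵀ + R)).PosSemidef := by
  rw [quadratic_sum_smul_eq Q S R Dbar l hsum _ rfl]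
  refine posSemidef_sum _ fun i _ => ((hvert i).add ?_).smul (hl i)
  simpa only [conjTranspose_eq_transpose_of_trivial] using
    hQ.mul_mul_conjTranspose_same (Dbar i - ∑ j, l j • Dbar j)
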